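/- For every integer r ≥ 1 and every n ≥ 1, the pair of statistics (exc_r, den) is equidistributed with (rdes, rmaj) over the symmetric group S_n; that is, for all integers a, b, the number of permutations σ ∈ S_n with exc_r(σ) = a and den(σ) = b equals the number of permutations σ ∈ S_n with rdes(σ) = a and rmaj(σ) = b. (Theorem 1.3: (exc_r, den) is r-Euler–Mahonian.) -/

import Mathlib

open Finset

namespace PaperStmt

/-- 1-based position of `i : Fin n` (so positions run through `1,…,n`). -/
def pos1 {n : ℕ} (i : Fin n) : ℕ := (i : ℕ) + 1

/-- 1-based value `σ_i` of the permutation `σ` at position `i`. -/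
def val1 {n : ℕ} (σ : Equiv.Perm (Fin n)) (i : Fin n) : ℕ := (σ i : ℕ) + 1

/-- The number of inversions of the subsequence of `σ` consisting of the letters at the
positions satisfying `P`: pairs of positions `i < j`, both satisfying `P`,
with `σ_i > σ_j`. -/
def invOn {n : ℕ} (σ : Equiv.Perm (Fin n)) (P : Fin n → Prop) [DecidablePred P] : ℕ :=
  (univ.filter fun p : Fin n × Fin n =>
    p.1 < p.2 ∧ P p.1 ∧ P p.2 ∧ val1 σ p.2 < val1 σ p.1).card

/-- `inv σ`: the number of inversions of `σ`. -/
def inv {n : ℕ} (σ : Equiv.Perm (Fin n)) : ℕ := invOn σ (fun _ => True)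

/-- `Exc(σ)`: the set of excedances, i.e. positions `i` with `σ_i > i`. -/
def excSet {n : ℕ} (σ : Equiv.Perm (Fin n)) : Finset (Fin n) :=
  univ.filter fun i => pos1 i < val1 σ i

/-- `exc σ`: the number of excedances. -/
def exc {n : ℕ} (σ : Equiv.Perm (Fin n)) : ℕ := (excSet σ).card

/-- `exc_r(σ)`: the number of `r`-level excedances, i.e. positions `i ≥ r` with `σ_i > i`. -/
def excLvl {n : ℕ} (r : ℕ) (σ : Equiv.Perm (Fin n)) : ℕ :=
  (univ.filter fun i => pos1 i < val1 σ i ∧ r ≤ pos1 i).card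

/-- Denert's statistic `den σ`. -/
def den {n : ℕ} (σ : Equiv.Perm (Fin n)) : ℕ :=
  ((univ.filter fun i => pos1 i < val1 σ i).sum pos1)
  + invOn σ (fun i => pos1 i < val1 σ i)
  + invOn σ (fun i => ¬ pos1 i < val1 σ i)

/-- The `h`-level Denert statistic `den_h(σ)`. -/
def denLvl {n : ℕ} (h : ℕ) (σ : Equiv.Perm (Fin n)) : ℕ :=
  ((univ.filter fun i => pos1 i < val1 σ i ∧ h ≤ val1 σ i).sum pos1)
  + invOn σ (fun i => pos1 i < val1 σ i ∧ h ≤ val1 σ i)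
  + invOn σ (fun i => ¬ (pos1 i < val1 σ i ∧ h ≤ val1 σ i))

/-- `g exc_ℓ(σ)`: the number of `g`-gap `ℓ`-level excedances,
i.e. positions `i ≥ ℓ` with `σ_i ≥ i + g`. -/
def gexc {n : ℕ} (g l : ℕ) (σ : Equiv.Perm (Fin n)) : ℕ :=
  (univ.filter fun i => pos1 i + g ≤ val1 σ i ∧ l ≤ pos1 i).card

/-- `gExclp_h(σ)`: the set of `g`-gap `h`-level excedance-letter positions,
i.e. positions `i` with `σ_i ≥ i + g` and `σ_i ≥ h`. -/
def gExclpSet {n : ℕ} (g h : ℕ) (σ : Equiv.Perm (Fin n)) : Finset (Fin n) :=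
  univ.filter fun i => pos1 i + g ≤ val1 σ i ∧ h ≤ val1 σ i

/-- The `g`-gap `h`-level Denert statistic `g den_h(σ)`. -/
def gden {n : ℕ} (g h : ℕ) (σ : Equiv.Perm (Fin n)) : ℕ :=
  ((univ.filter fun i => pos1 i + g ≤ val1 σ i ∧ h ≤ val1 σ i).sum fun i => pos1 i + g - 1)
  + invOn σ (fun i => pos1 i + g ≤ val1 σ i ∧ h ≤ val1 σ i)
  + invOn σ (fun i => ¬ (pos1 i + g ≤ val1 σ i ∧ h ≤ val1 σ i))

/-- `rexc σ`: the number of `r`-excedances, i.e. positions `i` with `σ_i ≥ i + r`. -/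
def rexc {n : ℕ} (r : ℕ) (σ : Equiv.Perm (Fin n)) : ℕ :=
  (univ.filter fun i => pos1 i + r ≤ val1 σ i).card

/-- The `r`-Denert statistic `rden σ`. -/
def rden {n : ℕ} (r : ℕ) (σ : Equiv.Perm (Fin n)) : ℕ :=
  ((univ.filter fun i => pos1 i + r ≤ val1 σ i).sum fun i => pos1 i + r - 1)
  + invOn σ (fun i => pos1 i + r ≤ val1 σ i)
  + invOn σ (fun i => ¬ pos1 i + r ≤ val1 σ i)

/-- Pairs `(i, i+1)` of adjacent positions forming an `r`-descent: `σ_i ≥ σ_{i+1} + r`. -/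
def rdesPairs {n : ℕ} (r : ℕ) (σ : Equiv.Perm (Fin n)) : Finset (Fin n × Fin n) :=
  univ.filter fun p => pos1 p.2 = pos1 p.1 + 1 ∧ val1 σ p.2 + r ≤ val1 σ p.1

/-- `rdes σ`: the number of `r`-descents. -/
def rdes {n : ℕ} (r : ℕ) (σ : Equiv.Perm (Fin n)) : ℕ := (rdesPairs r σ).card

/-- `rmaj σ`: the sum of the `r`-descents plus the number of pairs `i < j`
with `σ_j < σ_i < σ_j + r`. -/
def rmaj {n : ℕ} (r : ℕ) (σ : Equiv.Perm (Fin n)) : ℕ :=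
  ((rdesPairs r σ).sum fun p => pos1 p.1)
  + (univ.filter fun p : Fin n × Fin n =>
      p.1 < p.2 ∧ val1 σ p.2 < val1 σ p.1 ∧ val1 σ p.1 < val1 σ p.2 + r).card

/-- `des σ`: the number of descents, i.e. positions `i ∈ [n-1]` with `σ_i > σ_{i+1}`. -/
def des {n : ℕ} (σ : Equiv.Perm (Fin n)) : ℕ :=
  (univ.filter fun p : Fin n × Fin n =>
    pos1 p.2 = pos1 p.1 + 1 ∧ val1 σ p.2 < val1 σ p.1).card

/-- `maj σ`: the major index, i.e. the sum of the descents of `σ`. -/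
def maj {n : ℕ} (σ : Equiv.Perm (Fin n)) : ℕ :=
  ((univ.filter fun p : Fin n × Fin n =>
    pos1 p.2 = pos1 p.1 + 1 ∧ val1 σ p.2 < val1 σ p.1).sum fun p => pos1 p.1)

section RookSums

variable {R : Type*} [CommRing R]

/-- The `q`-integer `1 + q + ⋯ + q ^ (k - 1)`. -/
def qInt (q : R) (k : ℕ) : R := ∑ i ∈ range k, q ^ i

lemma qInt_succ (q : R) (k : ℕ) : qInt q (k + 1) = qInt q k + q ^ k := sum_range_succ _ _

lemma qInt_succ' (q : R) (k : ℕ) : qInt q (k + 1) = q * qInt q k + 1 := by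
  simp [qInt, sum_range_succ', mul_sum, pow_succ']

lemma qInt_add (q : R) (a b : ℕ) : qInt q (a + b) = qInt q a + q ^ a * qInt q b := by
  simp [qInt, sum_range_add, mul_sum, pow_add]

lemma sum_range_pow_reflect (q : R) (k : ℕ) :
    ∑ x ∈ range (k + 1), q ^ (k - x) = qInt q (k + 1) := by
  have := sum_range_reflect (fun i => q ^ i) (k + 1)
  simpa [qInt] using this

/-- The border `p` of a row after the column `x` has been deleted. -/
def shiftBorder (x p : ℕ) : ℕ := if x < p then p - 1 else p

/-- The rank of the column `x < N` in the cyclic order `p - 1, …, 0, N - 1, …, p`. -/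
def colRank (N p x : ℕ) : ℕ := if x < p then p - 1 - x else p + N - 1 - x

/-- The sum over the placements of rooks in `m` rows and `N` columns, processed from row `m - 1`
down to row `0`, of `q` to the sum of the cyclic ranks of the chosen columns times the value of
`f` at the number of rooks in a column at or beyond the border of its row. -/
def rookSum (q : R) : ℕ → ℕ → (ℕ → ℕ) → (ℕ → R) → R
  | 0, _, _, f => f 0
  | m + 1, N, p, f => ∑ x ∈ range N, q ^ colRank N (p m) x *
      rookSum q m (N - 1) (fun j => shiftBorder x (p j))
        (if x < p m then f else fun d => f (d + 1))

lemma rookSum_congr (q : R) (m N : ℕ) (p p' : ℕ → ℕ) (f : ℕ → R) (h : ∀ j < m, p j = p' j) :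
    rookSum q m N p f = rookSum q m N p' f := by
  induction m generalizing N p p' f with
  | zero => rfl
  | succ m ih =>
    simp only [rookSum, h m (by omega)]
    refine sum_congr rfl fun x _ => ?_
    rw [ih _ _ (fun j => shiftBorder x (p' j))]
    intro j hj
    rw [h j (by omega)]

lemma rookSum_linear (q : R) (m N : ℕ) (p : ℕ → ℕ) (a b : R) (f g : ℕ → R) :
    rookSum q m N p (fun d => a * f d + b * g d)
      = a * rookSum q m N p f + b * rookSum q m N p g := by
  induction m generalizing N p f g with
  | zero => rfl
  | succ m ih =>
    simp only [rookSum, mul_sum, ← sum_add_distrib]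
    refine sum_congr rfl fun x _ => ?_
    split_ifs
    · rw [ih]; ring
    · rw [ih _ _ (fun d => f (d + 1))]; ring

lemma shiftBorder_comm (x y p : ℕ) :
    shiftBorder y (shiftBorder x p) =
      if y < x then shiftBorder (x - 1) (shiftBorder y p)
      else shiftBorder x (shiftBorder (y + 1) p) := by
  unfold shiftBorder
  split_ifs <;> omega

/-- Processing first a row without board cells amounts to processing it last. -/
lemma sum_rookSum_shiftBorder (q : R) (m N : ℕ) (p : ℕ → ℕ) (f : ℕ → R) (hm : m ≤ N)
    (hp : ∀ j < m, p j ≤ N + 1) :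
    ∑ x ∈ range (N + 1), q ^ (N - x) * rookSum q m N (fun j => shiftBorder x (p j)) f
      = qInt q (N + 1 - m) * rookSum q m (N + 1) p f := by
  induction m generalizing N p f with
  | zero => simp only [rookSum, ← sum_mul, sum_range_pow_reflect]; simp
  | succ m ih =>
    obtain ⟨N, rfl⟩ : ∃ k, N = k + 1 := ⟨N - 1, by omega⟩
    have hpm := hp m (by omega)
    set P := p m with hP
    have rhs : qInt q (N + 1 + 1 - (m + 1)) * rookSum q (m + 1) (N + 1 + 1) p f
        = ∑ z ∈ range (N + 2), ∑ w ∈ range (N + 1), q ^ (colRank (N + 2) P z + (N - w)) *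
          rookSum q m N (fun j => shiftBorder w (shiftBorder z (p j)))
            (if z < P then f else fun d => f (d + 1)) := by
      simp only [rookSum, mul_sum]
      refine sum_congr rfl fun z hz => ?_
      have := ih N (fun j => shiftBorder z (p j)) (if z < P then f else fun d => f (d + 1))
        (by omega) (by
          intro j hj
          have := hp j (by omega)
          simp only [mem_range] at hz
          unfold shiftBorder; split_ifs <;> omega)
      simp only [pow_add, mul_assoc, ← mul_sum, this]
      simp only [Nat.add_sub_cancel, Nat.reduceSubDiff]
      ring
    rw [rhs]
    simp only [rookSum, ← hP, mul_sum, ← mul_assoc, ← pow_add, Nat.add_sub_cancel]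
    rw [← sum_product', ← sum_product']
    let e : ℕ × ℕ → ℕ × ℕ := fun u =>
      if u.1 < P ∧ u.2 < P - 1 ∨ P ≤ u.1 ∧ P ≤ u.2 then u
      else if u.2 < u.1 then (u.2, u.1 - 1) else (u.2 + 1, u.1)
    have he : ∀ u ∈ range (N + 2) ×ˢ range (N + 1), e u ∈ range (N + 2) ×ˢ range (N + 1) := by
      rintro ⟨x, y⟩ h
      simp only [mem_product, mem_range] at h
      simp only [e]
      split_ifs <;> simp only [mem_product, mem_range] <;> omega
    have hee : ∀ u ∈ range (N + 2) ×ˢ range (N + 1), e (e u) = u := by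
      rintro ⟨x, y⟩ h
      simp only [mem_product, mem_range] at h
      simp only [e]
      split_ifs <;> simp_all <;> omega
    refine sum_nbij' e e he he hee hee ?_
    rintro ⟨x, y⟩ h
    simp only [mem_product, mem_range] at h
    simp only [e]
    by_cases h1 : x < P ∧ y < P - 1 ∨ P ≤ x ∧ P ≤ y
    · rw [if_pos h1]
      have h2 : (y < shiftBorder x P) ↔ x < P := by unfold shiftBorder; split_ifs <;> omega
      simp only [h2]
      congr 2
      unfold colRank shiftBorder; split_ifs <;> omega
    · rw [if_neg h1]
      by_cases h2 : y < x
      · simp only [if_pos h2]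
        have h3 : (y < shiftBorder x P) ↔ y < P := by unfold shiftBorder; split_ifs <;> omega
        simp only [h3]
        congr 2
        · unfold colRank shiftBorder; split_ifs <;> omega
        · funext j; rw [shiftBorder_comm, if_pos h2]
      · simp only [if_neg h2]
        have h3 : (y < shiftBorder x P) ↔ y + 1 < P := by unfold shiftBorder; split_ifs <;> omega
        simp only [h3]
        congr 2
        · unfold colRank shiftBorder; split_ifs <;> omega
        · funext j; rw [shiftBorder_comm, if_neg h2]

/-- The operator on test functions that describes the passage from size `N` to size `N + 1`. -/
def stepOp (q : R) (N s : ℕ) (f : ℕ → R) (d : ℕ) : R :=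
  qInt q (d + s + 1) * f d + (qInt q (N + 1) - qInt q (d + s + 1)) * f (d + 1)

/-- Adding a column that belongs to the board in every row. -/
lemma qInt_mul_rookSum_succ (q : R) (m s : ℕ) (p : ℕ → ℕ) (f : ℕ → R)
    (hp : ∀ j < m, p j ≤ s + m) :
    qInt q (s + 1) * rookSum q m (s + m + 1) p f
      = rookSum q m (s + m) p (stepOp q (s + m) s f) := by
  induction m generalizing p f with
  | zero => simp [rookSum, stepOp]
  | succ m ih =>
    have hpm := hp m (by omega)
    set P := p m with hP
    have hsh : ∀ x < s + (m + 1), ∀ j < m, shiftBorder x (p j) ≤ s + m := by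
      intro x hx j hj
      have := hp j (by omega)
      unfold shiftBorder; split_ifs <;> omega
    have hB := sum_rookSum_shiftBorder q m (s + m) p (fun d => f (d + 1)) (by omega)
      (fun j hj => hp j (by omega))
    rw [show s + m + 1 - m = s + 1 by omega] at hB
    have hlast : rookSum q m (s + m + 1) (fun j => shiftBorder (s + (m + 1)) (p j))
        (fun d => f (d + 1)) = rookSum q m (s + m + 1) p (fun d => f (d + 1)) := by
      refine rookSum_congr _ _ _ _ _ _ fun j hj => ?_
      have := hp j (by omega)
      simp [shiftBorder, not_lt.2 this]
    have key : ∀ x ∈ range (s + (m + 1)),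
        q ^ colRank (s + (m + 1)) P x * rookSum q m (s + m) (fun j => shiftBorder x (p j))
          (if x < P then stepOp q (s + (m + 1)) s f
            else fun d => stepOp q (s + (m + 1)) s f (d + 1))
        = qInt q (s + 1) * (q ^ colRank (s + (m + 1) + 1) P x *
            rookSum q m (s + m + 1) (fun j => shiftBorder x (p j))
              (if x < P then f else fun d => f (d + 1)))
          + q ^ P * (q ^ (s + m - x) * rookSum q m (s + m) (fun j => shiftBorder x (p j))
              (fun d => f (d + 1))) := by
      intro x hx
      rw [mem_range] at hx
      by_cases hxP : x < P
      · simp only [if_pos hxP]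
        have h1 : stepOp q (s + (m + 1)) s f
            = fun d => 1 * stepOp q (s + m) s f d + q ^ (s + m + 1) * f (d + 1) := by
          funext d
          simp only [stepOp, ← add_assoc, qInt_succ q (s + m + 1)]
          ring
        rw [h1, rookSum_linear q m (s + m) _ 1 _ _ (fun d => f (d + 1)),
          ← ih _ _ (hsh x hx)]
        have h2 : colRank (s + (m + 1)) P x = colRank (s + (m + 1) + 1) P x := by
          simp [colRank, hxP]
        have h3 : q ^ colRank (s + (m + 1) + 1) P x * q ^ (s + m + 1)
            = q ^ P * q ^ (s + m - x) := by
          rw [← pow_add, ← pow_add]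
          congr 1
          simp only [colRank, hxP, if_true]; omega
        rw [h2, one_mul, mul_add, ← mul_assoc (q ^ _) (q ^ _), h3]
        ring
      · simp only [if_neg hxP]
        have h1 : (fun d => stepOp q (s + (m + 1)) s f (d + 1))
            = fun d => q * stepOp q (s + m) s (fun d => f (d + 1)) d + 1 * f (d + 1) := by
          funext d
          simp only [stepOp, ← add_assoc, qInt_succ' q (s + m + 1),
            show d + 1 + s + 1 = (d + s + 1) + 1 by ring, qInt_succ' q (d + s + 1)]
          ring
        rw [h1, rookSum_linear q m (s + m) _ q 1 _ (fun d => f (d + 1)),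
          ← ih _ _ (hsh x hx)]
        have h2 : colRank (s + (m + 1)) P x = P + (s + m - x) := by
          simp only [colRank, hxP, if_false]; omega
        have h3 : colRank (s + (m + 1) + 1) P x = P + (s + m - x) + 1 := by
          simp only [colRank, hxP, if_false]; omega
        rw [h2, h3]
        ring
    have hc : colRank (s + (m + 1) + 1) P (s + (m + 1)) = P := by
      simp only [colRank, not_lt.2 hpm, if_false]; omega
    simp only [rookSum, ← hP, Nat.add_sub_cancel, ← add_assoc s m 1] at key hc hlast hpm ⊢
    rw [sum_congr rfl key, sum_add_distrib, ← mul_sum, ← mul_sum, hB,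
      sum_range_succ _ (s + m + 1), hc, if_neg (not_lt.2 hpm), hlast]
    ring

end RookSums

section Insertion

/-- The permutation sending `i` to `x` and order-isomorphic to `σ` elsewhere. -/
def insertPerm {n : ℕ} (i x : Fin (n + 1)) (σ : Equiv.Perm (Fin n)) : Equiv.Perm (Fin (n + 1)) :=
  (finSuccEquiv' i).trans (σ.optionCongr.trans (finSuccEquiv' x).symm)

@[simp] lemma insertPerm_self {n : ℕ} (i x : Fin (n + 1)) (σ : Equiv.Perm (Fin n)) :
    insertPerm i x σ i = x := by
  simp [insertPerm]

@[simp] lemma insertPerm_succAbove {n : ℕ} (i x : Fin (n + 1)) (σ : Equiv.Perm (Fin n))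
    (j : Fin n) : insertPerm i x σ (i.succAbove j) = x.succAbove (σ j) := by
  simp [insertPerm]

lemma insertPerm_right_injective {n : ℕ} (i x : Fin (n + 1)) :
    Function.Injective (insertPerm i x) := by
  intro σ τ h
  ext j
  have : x.succAbove (σ j) = x.succAbove (τ j) := by
    rw [← insertPerm_succAbove i, ← insertPerm_succAbove i, h]
  rw [Fin.succAbove_right_injective this]

lemma sum_insertPerm_value {n : ℕ} {M : Type*} [AddCommMonoid M] (i : Fin (n + 1))
    (F : Equiv.Perm (Fin (n + 1)) → M) :
    ∑ τ, F τ = ∑ x, ∑ σ, F (insertPerm i x σ) := by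
  rw [← Fintype.sum_prod_type']
  refine (Function.Bijective.sum_comp (e := fun u : Fin (n + 1) × Equiv.Perm (Fin n) =>
    insertPerm i u.1 u.2) ?_ F).symm
  rw [Fintype.bijective_iff_injective_and_card]
  refine ⟨?_, by simp [Fintype.card_perm, Nat.factorial_succ]⟩
  rintro ⟨x, σ⟩ ⟨y, τ⟩ h
  have hxy : x = y := by simpa using congrArg (fun ρ => ρ i) h
  subst hxy
  exact congrArg (Prod.mk _) (insertPerm_right_injective i x h)

lemma sum_insertPerm_position {n : ℕ} {M : Type*} [AddCommMonoid M] (x : Fin (n + 1))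
    (F : Equiv.Perm (Fin (n + 1)) → M) :
    ∑ τ, F τ = ∑ i, ∑ σ, F (insertPerm i x σ) := by
  rw [← Fintype.sum_prod_type']
  refine (Function.Bijective.sum_comp (e := fun u : Fin (n + 1) × Equiv.Perm (Fin n) =>
    insertPerm u.1 x u.2) ?_ F).symm
  rw [Fintype.bijective_iff_injective_and_card]
  refine ⟨?_, by simp [Fintype.card_perm, Nat.factorial_succ]⟩
  rintro ⟨i, σ⟩ ⟨j, τ⟩ h
  have hij : i = j := by
    have h1 : insertPerm j x τ i = insertPerm j x τ j := by
      rw [insertPerm_self]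
      exact (congrArg (fun ρ => ρ i) h).symm.trans (insertPerm_self i x σ)
    exact (insertPerm j x τ).injective h1
  subst hij
  exact congrArg (Prod.mk _) (insertPerm_right_injective i x h)

end Insertion

section CyclicDenert

/-- The value `b` precedes `a` in the cyclic order `p - 1, …, 0, …, p + 1, p`. -/
def CycBetween (p a b : ℕ) : Prop := if a < p then a < b ∧ b < p else a < b ∨ b < p

instance (p a b : ℕ) : Decidable (CycBetween p a b) := by unfold CycBetween; infer_instance

/-- The cyclic form of Denert's statistic for rows with borders `p`. -/
def cycDen {n : ℕ} (p : ℕ → ℕ) (σ : Equiv.Perm (Fin n)) : ℕ :=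
  ∑ k : Fin n, ∑ l : Fin n, if l < k ∧ CycBetween (p k) (σ k) (σ l) then 1 else 0

/-- The number of rows of index at least `s` whose letter lies at or beyond the border. -/
def hits {n : ℕ} (s : ℕ) (p : ℕ → ℕ) (σ : Equiv.Perm (Fin n)) : ℕ :=
  ∑ k : Fin n, if p k ≤ σ k ∧ s ≤ (k : ℕ) then 1 else 0

lemma val_succAbove {n : ℕ} (x : Fin (n + 1)) (a : Fin n) :
    (x.succAbove a : ℕ) = if (a : ℕ) < x then (a : ℕ) else a + 1 := by
  simp only [Fin.succAbove, Fin.lt_def, Fin.val_castSucc]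
  split_ifs <;> rfl

lemma cycBetween_succAbove {n : ℕ} (x : Fin (n + 1)) (p : ℕ) (a b : Fin n) :
    CycBetween p (x.succAbove a) (x.succAbove b) ↔ CycBetween (shiftBorder x p) a b := by
  simp only [CycBetween, shiftBorder, val_succAbove]
  split_ifs <;> omega

lemma sum_cycBetween {N p : ℕ} (hp : p ≤ N) (x : Fin N) :
    (∑ b : Fin N, if CycBetween p x b then 1 else 0) = colRank N p x := by
  have hx := x.2
  rw [Fin.sum_univ_eq_sum_range (fun b => if CycBetween p x b then 1 else 0) N, sum_boole]
  by_cases h : (x : ℕ) < p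
  · have : (range N).filter (fun b => CycBetween p x b) = Ioo (x : ℕ) p := by
      ext b; simp only [mem_filter, mem_range, mem_Ioo, CycBetween, if_pos h]; omega
    simp only [this, Nat.card_Ioo, colRank, if_pos h, Nat.cast_id]; omega
  · have : (range N).filter (fun b => CycBetween p x b) = (range p).disjUnion (Ioo (x : ℕ) N)
        (by rw [disjoint_left]; intro a; simp only [mem_range, mem_Ioo]; omega) := by
      ext b
      simp only [mem_filter, mem_disjUnion, mem_range, mem_Ioo, CycBetween, if_neg h]; omega
    simp only [this, card_disjUnion, card_range, Nat.card_Ioo, colRank, if_neg h, Nat.cast_id]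
    omega

lemma cycDen_insertPerm {n : ℕ} (p : ℕ → ℕ) (hp : p n ≤ n + 1) (x : Fin (n + 1))
    (σ : Equiv.Perm (Fin n)) :
    cycDen p (insertPerm (Fin.last n) x σ)
      = cycDen (fun j => shiftBorder x (p j)) σ + colRank (n + 1) (p n) x := by
  have h (j : Fin n) : insertPerm (Fin.last n) x σ j.castSucc = x.succAbove (σ j) := by
    rw [← Fin.succAbove_last_apply, insertPerm_succAbove]
  rw [← sum_cycBetween hp x, Fin.sum_univ_succAbove _ x]
  simp only [cycDen, Fin.sum_univ_castSucc, insertPerm_self, h, cycBetween_succAbove,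
    Fin.castSucc_lt_castSucc_iff, Fin.castSucc_lt_last, Fin.val_castSucc, Fin.val_last]
  simp only [← cycBetween_succAbove, true_and,
    Equiv.sum_comp σ (fun b => if CycBetween (p n) x (x.succAbove b) then 1 else 0)]
  simp [CycBetween, not_lt.2 (Fin.le_last _)]

lemma hits_insertPerm {n : ℕ} (s : ℕ) (p : ℕ → ℕ) (x : Fin (n + 1)) (σ : Equiv.Perm (Fin n)) :
    hits s p (insertPerm (Fin.last n) x σ)
      = hits s (fun j => shiftBorder x (p j)) σ + if p n ≤ x ∧ s ≤ n then 1 else 0 := by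
  have h (j : Fin n) : insertPerm (Fin.last n) x σ j.castSucc = x.succAbove (σ j) := by
    rw [← Fin.succAbove_last_apply, insertPerm_succAbove]
  have h2 (j : Fin n) (P : ℕ) : P ≤ (x.succAbove (σ j) : ℕ) ↔ shiftBorder x P ≤ σ j := by
    simp only [shiftBorder, val_succAbove]
    split_ifs <;> omega
  simp only [hits, Fin.sum_univ_castSucc, h, h2, insertPerm_self, Fin.val_castSucc, Fin.val_last]

variable {R : Type*} [CommRing R]

lemma sum_pow_colRank (q : R) {N p : ℕ} (hp : p ≤ N) :
    ∑ x ∈ range N, q ^ colRank N p x = qInt q N := by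
  refine sum_nbij' (colRank N p) (colRank N p) ?_ ?_ ?_ ?_ (fun _ _ => rfl) <;>
    intro x hx <;> simp only [mem_range, colRank] at * <;> split_ifs <;> omega

lemma sum_cycDen_succ (q : R) (n s : ℕ) (p : ℕ → ℕ) (hp : p n ≤ n + 1) (f : ℕ → R) :
    ∑ τ : Equiv.Perm (Fin (n + 1)), q ^ cycDen p τ * f (hits s p τ)
      = ∑ x ∈ range (n + 1), q ^ colRank (n + 1) (p n) x *
          ∑ σ : Equiv.Perm (Fin n), q ^ cycDen (fun j => shiftBorder x (p j)) σ *
            f (hits s (fun j => shiftBorder x (p j)) σ + if p n ≤ x ∧ s ≤ n then 1 else 0) := by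
  rw [sum_insertPerm_value (Fin.last n), ← Fin.sum_univ_eq_sum_range (fun x =>
    q ^ colRank (n + 1) (p n) x *
      ∑ σ : Equiv.Perm (Fin n), q ^ cycDen (fun j => shiftBorder x (p j)) σ *
        f (hits s (fun j => shiftBorder x (p j)) σ + if p n ≤ x ∧ s ≤ n then 1 else 0))]
  refine sum_congr rfl fun x _ => ?_
  rw [mul_sum]
  refine sum_congr rfl fun σ _ => ?_
  rw [cycDen_insertPerm p hp, hits_insertPerm, pow_add]
  ring

lemma shiftBorder_le {x p N : ℕ} (hx : x < N + 1) (hp : p ≤ N + 1) : shiftBorder x p ≤ N := by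
  unfold shiftBorder; split_ifs <;> omega

lemma sum_cycDen_of_le (q : R) {n s : ℕ} (hn : n ≤ s) (p : ℕ → ℕ) (hp : ∀ k < n, p k ≤ n)
    (f : ℕ → R) :
    ∑ σ : Equiv.Perm (Fin n), q ^ cycDen p σ * f (hits s p σ)
      = (∏ i ∈ range n, qInt q (i + 1)) * f 0 := by
  induction n generalizing p with
  | zero => simp [cycDen, hits]
  | succ n ih =>
    rw [sum_cycDen_succ q n s p (hp n (by omega)), prod_range_succ,
      ← sum_pow_colRank q (hp n (by omega)), mul_comm (∏ i ∈ range n, _), mul_assoc, sum_mul]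
    refine sum_congr rfl fun x hx => ?_
    simp only [show ¬ s ≤ n by omega, and_false, if_false, add_zero]
    rw [ih (by omega) _ fun k hk => shiftBorder_le (mem_range.1 hx) (hp k (by omega))]

lemma sum_cycDen (q : R) (m s : ℕ) (p : ℕ → ℕ) (hp : ∀ k < s + m, p k ≤ s + m) (f : ℕ → R) :
    ∑ σ : Equiv.Perm (Fin (s + m)), q ^ cycDen p σ * f (hits s p σ)
      = (∏ i ∈ range s, qInt q (i + 1)) * rookSum q m (s + m) (fun j => p (s + j)) f := by
  induction m generalizing p f with
  | zero => exact sum_cycDen_of_le q le_rfl p hp f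
  | succ m ih =>
    refine (sum_cycDen_succ q (s + m) s p (hp _ (by omega)) f).trans ?_
    rw [rookSum, mul_sum]
    simp only [← add_assoc] at hp ⊢
    refine sum_congr rfl fun x hx => ?_
    have hp' : ∀ k < s + m, shiftBorder x (p k) ≤ s + m :=
      fun k hk => shiftBorder_le (mem_range.1 hx) (hp k (by omega))
    have hs : s ≤ s + m := by omega
    by_cases h : x < p (s + m)
    · simp only [not_le.2 h, false_and, if_false, h, if_true, add_zero, Nat.add_sub_cancel]
      rw [ih _ hp']; ring
    · simp only [not_lt.1 h, hs, and_self, h, if_true, if_false, Nat.add_sub_cancel]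
      rw [ih _ hp' (fun d => f (d + 1))]; ring

/-- Recursion for the joint distribution of the cyclic Denert statistic and the number of hits. -/
lemma sum_cycDen_recursion (q : R) (s m : ℕ) (f : ℕ → R) :
    ∑ τ : Equiv.Perm (Fin (s + m + 1)), q ^ cycDen (· + 1) τ * f (hits s (· + 1) τ)
      = ∑ σ : Equiv.Perm (Fin (s + m)), q ^ cycDen (· + 1) σ *
          stepOp q (s + m) s f (hits s (· + 1) σ) := by
  refine (sum_cycDen q (m + 1) s (· + 1) (fun k hk => hk) f).trans ?_
  rw [sum_cycDen q m s (· + 1) (fun k hk => hk),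
    ← qInt_mul_rookSum_succ q m s _ f (fun j hj => by omega)]
  congr 1
  have hB := sum_rookSum_shiftBorder q m (s + m) (fun j => s + j + 1) f (by omega)
    (fun j hj => by omega)
  rw [show s + m + 1 - m = s + 1 by omega] at hB
  rw [← hB, rookSum]
  refine sum_congr rfl fun x hx => ?_
  rw [mem_range] at hx
  have hc : colRank (s + m + 1) (s + m + 1) x = s + m - x := by
    simp only [colRank, hx, if_true]; omega
  simp only [← add_assoc, hc, hx, if_true, Nat.add_sub_cancel]

end CyclicDenert

section DenertFormula

lemma card_filter_pairs {n : ℕ} (P : Fin n × Fin n → Prop) [DecidablePred P] :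
    (univ.filter P).card = ∑ k, ∑ l, if P (l, k) then 1 else 0 := by
  rw [card_filter, Fintype.sum_prod_type_right]

lemma sum_crossing {n : ℕ} (σ : Equiv.Perm (Fin n)) (v : ℕ) :
    (∑ k : Fin n, if v ≤ k ∧ (σ k : ℕ) < v then 1 else 0)
      = ∑ k : Fin n, if (k : ℕ) < v ∧ v ≤ σ k then 1 else 0 := by
  have h := Equiv.sum_comp σ (fun k : Fin n => if (k : ℕ) < v then 1 else 0)
  have h1 : (∑ k : Fin n, if (σ k : ℕ) < v then 1 else 0)
      = (∑ k : Fin n, if v ≤ k ∧ (σ k : ℕ) < v then 1 else 0)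
        + ∑ k : Fin n, if (k : ℕ) < v ∧ (σ k : ℕ) < v then 1 else 0 := by
    rw [← sum_add_distrib]
    refine sum_congr rfl fun k _ => ?_
    split_ifs <;> omega
  have h2 : (∑ k : Fin n, if (k : ℕ) < v then 1 else 0)
      = (∑ k : Fin n, if (k : ℕ) < v ∧ v ≤ σ k then 1 else 0)
        + ∑ k : Fin n, if (k : ℕ) < v ∧ (σ k : ℕ) < v then 1 else 0 := by
    rw [← sum_add_distrib]
    refine sum_congr rfl fun k _ => ?_
    split_ifs <;> omega
  omega

lemma sum_excedance_arcs {n : ℕ} (σ : Equiv.Perm (Fin n)) :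
    (∑ k : Fin n, ∑ l : Fin n,
        if (l : ℕ) < σ l ∧ (σ l : ℕ) ≤ k ∧ (σ k : ℕ) < σ l then 1 else 0)
      = ∑ k : Fin n, ∑ l : Fin n,
        if (k : ℕ) < σ k ∧ (l : ℕ) ≤ k ∧ (k : ℕ) < σ l then 1 else 0 := by
  set P := ∑ k : Fin n, ∑ l : Fin n,
        if (k : ℕ) < σ k ∧ (l : ℕ) ≤ k ∧ (k : ℕ) < σ l then 1 else 0 with hP
  set Z := ∑ k : Fin n, ∑ l : Fin n,
        if (k : ℕ) < σ k ∧ (l : ℕ) < σ l ∧ (σ l : ℕ) ≤ k then 1 else 0 with hZ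
  set L : Fin n → Fin n → ℕ := fun k l =>
        if (k : ℕ) < σ k ∧ (l : ℕ) < σ l ∧ (l : ℕ) ≤ k then 1 else 0 with hL
  set L' : Fin n → Fin n → ℕ := fun k l =>
        if (k : ℕ) < σ k ∧ (l : ℕ) < σ l ∧ (σ l : ℕ) ≤ σ k then 1 else 0 with hL'
  have h1 : (∑ k : Fin n, ∑ l : Fin n,
        if (l : ℕ) < σ l ∧ (σ l : ℕ) ≤ k ∧ (σ k : ℕ) < σ l then 1 else 0)
      = ∑ k : Fin n, ∑ l : Fin n,
        if (l : ℕ) < σ l ∧ (k : ℕ) < σ l ∧ (σ l : ℕ) ≤ σ k then 1 else 0 := by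
    rw [sum_comm]
    conv_rhs => rw [sum_comm]
    refine sum_congr rfl fun l _ => ?_
    by_cases h : (l : ℕ) < σ l
    · simpa only [h, true_and] using sum_crossing σ (σ l)
    · simp only [h, false_and]
  have h2 : P + Z = ∑ k, ∑ l, L k l := by
    simp only [hP, hZ, hL, ← sum_add_distrib]
    refine sum_congr rfl fun k _ => sum_congr rfl fun l _ => ?_
    split_ifs <;> omega
  have h3 : (∑ k : Fin n, ∑ l : Fin n,
        if (l : ℕ) < σ l ∧ (k : ℕ) < σ l ∧ (σ l : ℕ) ≤ σ k then 1 else 0) + Z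
      = ∑ k, ∑ l, L' k l := by
    simp only [hZ, hL', ← sum_add_distrib]
    refine sum_congr rfl fun k _ => sum_congr rfl fun l _ => ?_
    split_ifs <;> omega
  have h4 : (∑ k, ∑ l, L k l) + ∑ k, ∑ l, L l k = (∑ k, ∑ l, L' k l) + ∑ k, ∑ l, L' l k := by
    simp only [← sum_add_distrib]
    refine sum_congr rfl fun k _ => sum_congr rfl fun l _ => ?_
    have h : (σ k : ℕ) = σ l ↔ (k : ℕ) = l := by
      rw [← Fin.ext_iff, σ.injective.eq_iff, Fin.ext_iff]
    simp only [hL, hL']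
    split_ifs <;> omega
  rw [sum_comm (f := fun k l => L l k), sum_comm (f := fun k l => L' l k)] at h4
  omega

/-- Denert's statistic in the cyclic form of Foata and Zeilberger. -/
lemma den_eq_cycDen {n : ℕ} (σ : Equiv.Perm (Fin n)) : den σ = cycDen (· + 1) σ := by
  have hpos : (univ.filter fun i => pos1 i < val1 σ i).sum pos1
      = (∑ k : Fin n, ∑ l : Fin n, if (k : ℕ) < σ k ∧ l < k ∧ (σ l : ℕ) ≤ k then 1 else 0)
        + ∑ k : Fin n, ∑ l : Fin n,
          if (k : ℕ) < σ k ∧ (l : ℕ) ≤ k ∧ (k : ℕ) < σ l then 1 else 0 := by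
    rw [sum_filter, ← sum_add_distrib]
    refine sum_congr rfl fun k _ => ?_
    have hk : pos1 k = ∑ l : Fin n, if (l : ℕ) ≤ k then 1 else 0 := by
      rw [Fin.sum_univ_eq_sum_range (fun l => if l ≤ (k : ℕ) then 1 else 0) n, sum_boole]
      have : (range n).filter (· ≤ (k : ℕ)) = range (k + 1) := by
        ext a; simp only [mem_filter, mem_range]; omega
      simp [this, pos1]
    by_cases h : (k : ℕ) < σ k
    · rw [if_pos (by simpa [pos1, val1] using h), hk, ← sum_add_distrib]
      refine sum_congr rfl fun l _ => ?_
      have : (l : ℕ) = k → (σ l : ℕ) = σ k := fun h => by rw [Fin.ext h]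
      simp only [Fin.lt_def]
      split_ifs <;> omega
    · rw [if_neg (by simpa [pos1, val1] using h)]
      simp [h]
  rw [den, hpos, ← sum_excedance_arcs, invOn, invOn, card_filter_pairs, card_filter_pairs, cycDen]
  simp only [← sum_add_distrib]
  refine sum_congr rfl fun k _ => sum_congr rfl fun l _ => ?_
  simp only [pos1, val1, CycBetween, Fin.lt_def]
  split_ifs <;> omega

lemma excLvl_eq_hits {n : ℕ} (s : ℕ) (σ : Equiv.Perm (Fin n)) :
    excLvl (s + 1) σ = hits s (· + 1) σ := by
  rw [excLvl, hits, card_filter]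
  refine sum_congr rfl fun k _ => if_congr ?_ rfl rfl
  simp only [pos1, val1]
  omega

end DenertFormula

section MaxInsertion

/-- The one-line word of `σ`, continued by the constant `n`. -/
def word {n : ℕ} (σ : Equiv.Perm (Fin n)) (j : ℕ) : ℕ := if h : j < n then σ ⟨j, h⟩ else n

lemma word_of_lt {n : ℕ} (σ : Equiv.Perm (Fin n)) {j : ℕ} (h : j < n) : word σ j = σ ⟨j, h⟩ :=
  dif_pos h

lemma word_of_le {n : ℕ} (σ : Equiv.Perm (Fin n)) {j : ℕ} (h : n ≤ j) : word σ j = n :=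
  dif_neg (not_lt.2 h)

lemma word_le {n : ℕ} (σ : Equiv.Perm (Fin n)) (j : ℕ) : word σ j ≤ n := by
  unfold word; split_ifs
  · exact (σ _).2.le
  · exact le_rfl

lemma sum_rdesPairs {n : ℕ} (r : ℕ) (σ : Equiv.Perm (Fin n)) (φ : ℕ → ℕ) :
    (rdesPairs r σ).sum (fun p => φ p.1)
      = ∑ j ∈ range (n - 1), if word σ (j + 1) + r ≤ word σ j then φ j else 0 := by
  have key : ∀ a : Fin n, (∑ b : Fin n,
      if pos1 b = pos1 a + 1 ∧ val1 σ b + r ≤ val1 σ a then φ a else 0)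
      = if (a : ℕ) < n - 1 ∧ word σ (a + 1) + r ≤ word σ a then φ a else 0 := by
    intro a
    by_cases h : (a : ℕ) + 1 < n
    · rw [sum_eq_single ⟨a + 1, h⟩]
      · rw [word_of_lt σ h, word_of_lt σ a.2]
        refine if_congr ?_ rfl rfl
        have h' : (a : ℕ) < n - 1 := by omega
        simp only [pos1, val1, Fin.eta, h', true_and]
        omega
      · intro b _ hb
        rw [if_neg]
        rintro ⟨h1, -⟩
        exact hb (Fin.ext (by simpa [pos1] using h1))
      · simp
    · rw [if_neg (by omega)]
      refine sum_eq_zero fun b _ => if_neg ?_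
      rintro ⟨h1, -⟩
      have := b.2
      simp only [pos1] at h1
      omega
  rw [rdesPairs, sum_filter, Fintype.sum_prod_type, sum_congr rfl fun a _ => key a,
    Fin.sum_univ_eq_sum_range
      (fun a => if a < n - 1 ∧ word σ (a + 1) + r ≤ word σ a then φ a else 0) n]
  rw [← sum_filter, ← sum_filter]
  refine sum_congr ?_ fun _ _ => rfl
  ext a; simp only [mem_filter, mem_range]; omega

lemma sum_rdesPairs' {n : ℕ} {r : ℕ} (hr : 1 ≤ r) (σ : Equiv.Perm (Fin n)) (φ : ℕ → ℕ) :
    (rdesPairs r σ).sum (fun p => φ p.1)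
      = ∑ j ∈ range n, if word σ (j + 1) + r ≤ word σ j then φ j else 0 := by
  rw [sum_rdesPairs]
  rcases n with _ | n
  · simp
  · have := word_le σ n
    rw [sum_range_succ, word_of_le σ le_rfl, if_neg (by omega)]
    simp

lemma word_insertPerm {n : ℕ} (i : Fin (n + 1)) (σ : Equiv.Perm (Fin n)) {j : ℕ}
    (hj : j < n + 1) :
    word (insertPerm i (Fin.last n) σ) j
      = if j < i then word σ j else if j = i then n else word σ (j - 1) := by
  rw [word_of_lt _ hj]
  rcases lt_trichotomy j i with h | h | h
  · have hj' : j < n := by omega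
    have : (⟨j, hj⟩ : Fin (n + 1)) = i.succAbove ⟨j, hj'⟩ := by
      ext; rw [val_succAbove]; simp [h]
    rw [this, insertPerm_succAbove, if_pos h, word_of_lt σ hj']
    simp
  · have : (⟨j, hj⟩ : Fin (n + 1)) = i := Fin.ext h
    rw [this, insertPerm_self]
    simp [h]
  · have hj' : j - 1 < n := by omega
    have : (⟨j, hj⟩ : Fin (n + 1)) = i.succAbove ⟨j - 1, hj'⟩ := by
      ext; rw [val_succAbove]; simp only; split_ifs <;> omega
    rw [this, insertPerm_succAbove, if_neg (by omega), if_neg (by omega), word_of_lt σ hj']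
    simp

/-- The weighted sum over the descents of a word after the insertion of a maximal letter. -/
lemma sum_descents_insert {n i r : ℕ} (hr : 1 ≤ r) (hi : i ≤ n) (w w' φ : ℕ → ℕ)
    (hw : ∀ j, w j ≤ n) (hn : w n = n)
    (hw' : ∀ j < n + 1, w' j = if j < i then w j else if j = i then n else w (j - 1)) :
    (∑ j ∈ range n, if w' (j + 1) + r ≤ w' j then φ j else 0)
        + (if 0 < i ∧ w i + r ≤ w (i - 1) then φ (i - 1) else 0)
      = (∑ j ∈ range n, if w (j + 1) + r ≤ w j then (if j < i then φ j else φ (j + 1)) else 0)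
        + if w i + r ≤ n then φ i else 0 := by
  obtain ⟨k, rfl⟩ := Nat.exists_eq_add_of_le hi
  have left : (∑ j ∈ range i, if w' (j + 1) + r ≤ w' j then φ j else 0)
        + (if 0 < i ∧ w i + r ≤ w (i - 1) then φ (i - 1) else 0)
      = ∑ j ∈ range i, if w (j + 1) + r ≤ w j then (if j < i then φ j else φ (j + 1)) else 0 := by
    rcases i with _ | i
    · simp
    · have h1 : ∀ j ∈ range i, (if w' (j + 1) + r ≤ w' j then φ j else 0)
          = if w (j + 1) + r ≤ w j then (if j < i + 1 then φ j else φ (j + 1)) else 0 := by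
        intro j hj
        rw [mem_range] at hj
        rw [hw' (j + 1) (by omega), hw' j (by omega), if_pos (by omega : j + 1 < i + 1),
          if_pos (by omega : j < i + 1), if_pos (by omega : j < i + 1)]
      have h2 := hw i
      rw [sum_range_succ, sum_range_succ, sum_congr rfl h1, hw' (i + 1) (by omega),
        hw' i (by omega)]
      simp only [lt_irrefl, if_false, if_true, Nat.lt_succ_self, Nat.succ_pos, true_and,
        Nat.add_sub_cancel]
      rw [if_neg (by omega : ¬ i + 1 + k + r ≤ w i), add_zero]
  have right : (∑ j ∈ range k, if w' (i + j + 1) + r ≤ w' (i + j) then φ (i + j) else 0)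
      = (∑ j ∈ range k, if w (i + j + 1) + r ≤ w (i + j) then
          (if i + j < i then φ (i + j) else φ (i + j + 1)) else 0)
        + if w i + r ≤ i + k then φ i else 0 := by
    rcases k with _ | k
    · simp only [add_zero] at hn
      simp [hn]; omega
    · have h1 : ∀ j ∈ range k,
          (if w' (i + (j + 1) + 1) + r ≤ w' (i + (j + 1)) then φ (i + (j + 1)) else 0)
          = if w (i + j + 1) + r ≤ w (i + j) then
              (if i + j < i then φ (i + j) else φ (i + j + 1)) else 0 := by
        intro j hj
        rw [mem_range] at hj
        have e1 : w' (i + (j + 1) + 1) = w (i + j + 1) := by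
          rw [hw' _ (by omega), if_neg (by omega), if_neg (by omega)]; rfl
        have e2 : w' (i + (j + 1)) = w (i + j) := by
          rw [hw' _ (by omega), if_neg (by omega), if_neg (by omega)]; rfl
        rw [e1, e2, if_neg (by omega : ¬ i + j < i)]
        rfl
      have h2 := hw (i + k)
      have e1 : w' (i + 1) = w i := by
        rw [hw' _ (by omega), if_neg (by omega), if_neg (by omega)]; rfl
      have e2 : w' i = i + (k + 1) := by
        rw [hw' _ (by omega), if_neg (by omega), if_pos rfl]
      rw [sum_range_succ', sum_range_succ, sum_congr rfl h1, add_zero, e1, e2,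
        show i + k + 1 = i + (k + 1) by ring, hn, if_neg (by omega : ¬ i + (k + 1) + r ≤ w (i + k)), add_zero]
  rw [sum_range_add, sum_range_add, right, ← left]
  ring

lemma sum_inversions_insertPerm {n : ℕ} (r : ℕ) (i : Fin (n + 1)) (σ : Equiv.Perm (Fin n)) :
    (univ.filter fun p : Fin (n + 1) × Fin (n + 1) => p.1 < p.2 ∧
        val1 (insertPerm i (Fin.last n) σ) p.2 < val1 (insertPerm i (Fin.last n) σ) p.1 ∧
        val1 (insertPerm i (Fin.last n) σ) p.1 < val1 (insertPerm i (Fin.last n) σ) p.2 + r).card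
      = (univ.filter fun p : Fin n × Fin n =>
          p.1 < p.2 ∧ val1 σ p.2 < val1 σ p.1 ∧ val1 σ p.1 < val1 σ p.2 + r).card
        + ∑ b ∈ range n, if (i : ℕ) ≤ b ∧ n < word σ b + r then 1 else 0 := by
  rw [card_filter_pairs, card_filter_pairs,
    ← Fin.sum_univ_eq_sum_range (fun b => if (i : ℕ) ≤ b ∧ n < word σ b + r then 1 else 0),
    Fin.sum_univ_succAbove _ i]
  have h0 : (∑ l : Fin (n + 1), if l < i ∧
        val1 (insertPerm i (Fin.last n) σ) i < val1 (insertPerm i (Fin.last n) σ) l ∧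
        val1 (insertPerm i (Fin.last n) σ) l < val1 (insertPerm i (Fin.last n) σ) i + r
        then 1 else 0) = 0 := by
    refine sum_eq_zero fun l _ => if_neg ?_
    rintro ⟨-, h, -⟩
    have := (insertPerm i (Fin.last n) σ l).2
    simp only [val1, insertPerm_self, Fin.val_last] at h
    omega
  rw [h0, zero_add, ← sum_add_distrib]
  refine sum_congr rfl fun b _ => ?_
  rw [Fin.sum_univ_succAbove _ i, add_comm]
  congr 1
  · refine sum_congr rfl fun a _ => if_congr ?_ rfl rfl
    simp [val1, Fin.succAbove_lt_succAbove_iff]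
  · refine if_congr ?_ rfl rfl
    have := (σ b).2
    simp only [val1, insertPerm_self, insertPerm_succAbove, Fin.lt_def, val_succAbove,
      Fin.val_last, word_of_lt σ b.2, Fin.eta]
    split_ifs <;> omega

lemma sum_range_split (s : ℕ → Prop) [DecidablePred s] {i N : ℕ} (hi : i < N) :
    (∑ j ∈ range N, if s j then 1 else 0)
      = (∑ j ∈ range i, if s j then 1 else 0) + (if s i then 1 else 0)
        + ∑ j ∈ range N, if i < j ∧ s j then 1 else 0 := by
  obtain ⟨k, rfl⟩ := Nat.exists_eq_add_of_le (Nat.succ_le_of_lt hi)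
  have hz : (∑ j ∈ range (i + 1), if i < j ∧ s j then 1 else 0) = 0 := by
    refine sum_eq_zero fun j hj => if_neg ?_
    rw [mem_range] at hj; omega
  have hp : ∀ x, i < i + 1 + x := fun x => by omega
  rw [Nat.succ_eq_add_one, sum_range_add _ (i + 1) k, sum_range_add _ (i + 1) k,
    sum_range_succ _ i, hz]
  simp [hp]

/-- The gap `i` is special when inserting the maximal letter there creates no new `r`-descent. -/
def SpecialGap (r n : ℕ) (w : ℕ → ℕ) (i : ℕ) : Prop :=
  (0 < i ∧ w i + r ≤ w (i - 1)) ∨ n < w i + r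

instance (r n : ℕ) (w : ℕ → ℕ) (i : ℕ) : Decidable (SpecialGap r n w i) := by
  unfold SpecialGap; infer_instance

/-- The label of position `i < N`: positions satisfying `s` are numbered from right to left,
followed by the remaining ones from left to right. -/
def label (s : ℕ → Prop) [DecidablePred s] (N i : ℕ) : ℕ :=
  if s i then ∑ j ∈ range N, if i < j ∧ s j then 1 else 0
  else (∑ j ∈ range N, if s j then 1 else 0) + ∑ j ∈ range i, if s j then 0 else 1

lemma sum_ite_compl (s : ℕ → Prop) [DecidablePred s] (N : ℕ) :
    (∑ j ∈ range N, if s j then 1 else 0) + (∑ j ∈ range N, if s j then 0 else 1) = N := by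
  rw [← sum_add_distrib]
  refine (sum_congr rfl fun j _ => ?_).trans (card_eq_sum_ones (range N)).symm |>.trans (by simp)
  split_ifs <;> rfl

section Labels

variable {R : Type*} [CommRing R]

lemma sum_label_pos (q : R) (s : ℕ → Prop) [DecidablePred s] (N : ℕ) :
    (∑ i ∈ range N, if s i then q ^ (∑ j ∈ range N, if i < j ∧ s j then 1 else 0) else 0)
      = qInt q (∑ j ∈ range N, if s j then 1 else 0) := by
  induction N with
  | zero => simp [qInt]
  | succ N ih =>
    have hlast : (∑ j ∈ range (N + 1), if N < j ∧ s j then 1 else 0) = 0 := by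
      refine sum_eq_zero fun j hj => if_neg ?_
      rw [mem_range] at hj; omega
    have hstep : ∀ i ∈ range N,
        (if s i then q ^ (∑ j ∈ range (N + 1), if i < j ∧ s j then 1 else 0) else 0)
        = q ^ (if s N then 1 else 0) *
          if s i then q ^ (∑ j ∈ range N, if i < j ∧ s j then 1 else 0) else 0 := by
      intro i hi
      rw [mem_range] at hi
      simp only [sum_range_succ, hi, true_and, pow_add, mul_ite, mul_zero]
      split_ifs <;> ring
    rw [sum_range_succ, hlast, sum_congr rfl hstep, ← mul_sum, ih, sum_range_succ]
    split_ifs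
    · rw [qInt_succ']; simp
    · simp

lemma sum_label_neg (q : R) (s : ℕ → Prop) [DecidablePred s] (N : ℕ) :
    (∑ i ∈ range N, if s i then 0 else q ^ (∑ j ∈ range i, if s j then 0 else 1))
      = qInt q (∑ j ∈ range N, if s j then 0 else 1) := by
  induction N with
  | zero => simp [qInt]
  | succ N ih =>
    rw [sum_range_succ, ih, sum_range_succ]
    split_ifs
    · simp
    · rw [qInt_succ]

lemma sum_pow_label (q : R) (s : ℕ → Prop) [DecidablePred s] (N : ℕ) (a b : R) :
    ∑ i ∈ range N, q ^ label s N i * (if s i then a else b)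
      = qInt q (∑ j ∈ range N, if s j then 1 else 0) * a
        + (qInt q N - qInt q (∑ j ∈ range N, if s j then 1 else 0)) * b := by
  have hN := congrArg (qInt q) (sum_ite_compl s N)
  rw [qInt_add, ← sum_label_neg q s N] at hN
  rw [← hN, add_sub_cancel_left, ← sum_label_pos q s N, sum_mul, mul_sum, sum_mul,
    ← sum_add_distrib]
  refine sum_congr rfl fun i _ => ?_
  unfold label
  split_ifs
  · ring
  · rw [pow_add]; ring

end Labels

lemma rdes_eq_sum {n r : ℕ} (hr : 1 ≤ r) (σ : Equiv.Perm (Fin n)) :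
    rdes r σ = ∑ j ∈ range n, if word σ (j + 1) + r ≤ word σ j then 1 else 0 := by
  rw [rdes, card_eq_sum_ones]
  exact sum_rdesPairs' hr σ fun _ => 1

lemma card_specialGap {n r : ℕ} (hr : 1 ≤ r) (σ : Equiv.Perm (Fin n)) :
    (∑ j ∈ range (n + 1), if SpecialGap r n (word σ) j then 1 else 0)
      = rdes r σ + min (r - 1) n + 1 := by
  have hbig : (∑ j ∈ range n, if n < word σ j + r then 1 else 0) = min (r - 1) n := by
    rw [← Fin.sum_univ_eq_sum_range (fun j => if n < word σ j + r then 1 else 0)]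
    have h1 : ∀ j : Fin n, (if n < word σ j + r then 1 else 0)
        = (fun v : Fin n => if n < (v : ℕ) + r then 1 else 0) (σ j) := by
      intro j; simp only [word_of_lt σ j.2, Fin.eta]
    rw [sum_congr rfl fun j _ => h1 j,
      Equiv.sum_comp σ fun v : Fin n => if n < (v : ℕ) + r then 1 else 0,
      Fin.sum_univ_eq_sum_range (fun v => if n < v + r then 1 else 0), sum_boole]
    have : (range n).filter (fun v => n < v + r) = Ico (n + 1 - r) n := by
      ext v; simp only [mem_filter, mem_range, mem_Ico]; omega
    rw [this, Nat.cast_id, Nat.card_Ico]; omega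
  have hsplit : ∀ j ∈ range (n + 1), (if SpecialGap r n (word σ) j then 1 else 0)
      = (if 0 < j ∧ word σ j + r ≤ word σ (j - 1) then 1 else 0)
        + if n < word σ j + r then 1 else 0 := by
    intro j _
    have := word_le σ (j - 1)
    by_cases hs : SpecialGap r n (word σ) j
    · rw [if_pos hs]
      unfold SpecialGap at hs
      split_ifs <;> omega
    · rw [if_neg hs]
      unfold SpecialGap at hs
      split_ifs <;> omega
  rw [sum_congr rfl hsplit, sum_add_distrib, sum_range_succ', sum_range_succ _ n, hbig,
    word_of_le σ le_rfl, if_pos (by omega : n < n + r), rdes_eq_sum hr]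
  simp
  ring

lemma rdes_insertPerm {n r : ℕ} (hr : 1 ≤ r) (i : Fin (n + 1)) (σ : Equiv.Perm (Fin n)) :
    rdes r (insertPerm i (Fin.last n) σ)
      = rdes r σ + if SpecialGap r n (word σ) i then 0 else 1 := by
  have h := sum_descents_insert hr (Nat.lt_succ_iff.1 i.2) (word σ)
    (word (insertPerm i (Fin.last n) σ)) (fun _ => 1) (word_le σ) (word_of_le σ le_rfl)
    (fun j hj => word_insertPerm i σ hj)
  have h1 := sum_rdesPairs r (insertPerm i (Fin.last n) σ) fun _ => 1
  rw [← card_eq_sum_ones, ← rdes, Nat.add_sub_cancel] at h1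
  rw [← h1] at h
  simp only [ite_self] at h
  rw [← rdes_eq_sum hr] at h
  have := word_le σ (i - 1)
  by_cases hs : SpecialGap r n (word σ) i
  · rw [if_pos hs]
    unfold SpecialGap at hs
    split_ifs at h <;> omega
  · rw [if_neg hs]
    unfold SpecialGap at hs
    split_ifs at h <;> omega

lemma rmaj_insertPerm {n r : ℕ} (hr : 1 ≤ r) (i : Fin (n + 1)) (σ : Equiv.Perm (Fin n)) :
    rmaj r (insertPerm i (Fin.last n) σ)
      = rmaj r σ + label (SpecialGap r n (word σ)) (n + 1) i := by
  set w := word σ with hw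
  have hi := i.2
  have hwn : w n = n := word_of_le σ le_rfl
  have h := sum_descents_insert hr (Nat.lt_succ_iff.1 i.2) w
    (word (insertPerm i (Fin.last n) σ)) (fun j => j + 1) (word_le σ) hwn
    (fun j hj => word_insertPerm i σ hj)
  have h1 := sum_rdesPairs r (insertPerm i (Fin.last n) σ) fun j => j + 1
  rw [Nat.add_sub_cancel] at h1
  rw [← h1] at h
  have h2 : (∑ j ∈ range n, if w (j + 1) + r ≤ w j then
        (if j < (i : ℕ) then j + 1 else j + 1 + 1) else 0)
      = (rdesPairs r σ).sum (fun p => (p.1 : ℕ) + 1)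
        + ∑ j ∈ range n, if (i : ℕ) ≤ j ∧ w (j + 1) + r ≤ w j then 1 else 0 := by
    rw [sum_rdesPairs' hr σ fun j => j + 1, ← sum_add_distrib]
    refine sum_congr rfl fun j _ => ?_
    rw [← hw]
    split_ifs <;> omega
  rw [h2] at h
  have h3 : (∑ b ∈ range n, if (i : ℕ) ≤ b ∧ n < w b + r then 1 else 0)
      = (∑ b ∈ range n, if (i : ℕ) < b ∧ n < w b + r then 1 else 0)
        + if (i : ℕ) < n ∧ n < w i + r then 1 else 0 := by
    have : (if (i : ℕ) < n ∧ n < w i + r then 1 else 0)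
        = ∑ b ∈ range n, if b = (i : ℕ) then (if n < w b + r then 1 else 0) else 0 := by
      rw [sum_ite_eq' (range n) (i : ℕ)]
      simp only [mem_range]
      split_ifs <;> omega
    rw [this, ← sum_add_distrib]
    refine sum_congr rfl fun b _ => ?_
    split_ifs <;> omega
  have h4 : (∑ j ∈ range (n + 1), if (i : ℕ) < j ∧ SpecialGap r n w j then 1 else 0)
      = (∑ j ∈ range n, if (i : ℕ) ≤ j ∧ w (j + 1) + r ≤ w j then 1 else 0)
        + (∑ b ∈ range n, if (i : ℕ) < b ∧ n < w b + r then 1 else 0)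
        + if (i : ℕ) < n then 1 else 0 := by
    have hsplit : ∀ j ∈ range (n + 1), (if (i : ℕ) < j ∧ SpecialGap r n w j then 1 else 0)
        = (if (i : ℕ) < j ∧ 0 < j ∧ w j + r ≤ w (j - 1) then 1 else 0)
          + if (i : ℕ) < j ∧ n < w j + r then 1 else 0 := by
      intro j _
      have : w (j - 1) ≤ n := word_le σ (j - 1)
      by_cases hs : SpecialGap r n w j
      · unfold SpecialGap at hs ⊢
        rw [if_congr (and_iff_left hs) rfl rfl]
        split_ifs <;> omega
      · rw [if_neg fun h => hs h.2]
        unfold SpecialGap at hs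
        split_ifs <;> omega
    rw [sum_congr rfl hsplit, sum_add_distrib, sum_range_succ', sum_range_succ _ n, hwn]
    have hr' : n < n + r := by omega
    simp [hr', add_assoc]
  have h5 : (∑ j ∈ range (n + 1), if SpecialGap r n w j then 1 else 0)
      = (∑ j ∈ range i, if SpecialGap r n w j then 1 else 0)
        + (if SpecialGap r n w i then 1 else 0)
        + ∑ j ∈ range (n + 1), if (i : ℕ) < j ∧ SpecialGap r n w j then 1 else 0 :=
    sum_range_split _ hi
  have h6 := sum_ite_compl (SpecialGap r n w) i
  have h7 := sum_inversions_insertPerm r i σ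
  rw [← hw, h3] at h7
  have hmaj (N : ℕ) (ρ : Equiv.Perm (Fin N)) : rmaj r ρ
      = (rdesPairs r ρ).sum (fun p => (p.1 : ℕ) + 1) + (univ.filter fun p : Fin N × Fin N =>
        p.1 < p.2 ∧ val1 ρ p.2 < val1 ρ p.1 ∧ val1 ρ p.1 < val1 ρ p.2 + r).card := rfl
  have hw1 : w (i - 1) ≤ n := word_le σ _
  have hin : (i : ℕ) = n → w i = n := fun h => by rw [h, hwn]
  rw [hmaj, hmaj, h7, label, h5, h4]
  clear h1 h2 h3 h4 h5 h7 hmaj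
  by_cases hs : SpecialGap r n w i
  · rw [if_pos hs]
    unfold SpecialGap at hs
    split_ifs at h ⊢ <;> omega
  · rw [if_neg hs]
    rw [if_neg hs]
    unfold SpecialGap at hs
    split_ifs at h ⊢ <;> omega

/-- Recursion for the joint distribution of `rmaj` and `rdes`. -/
lemma sum_rmaj_recursion {R : Type*} [CommRing R] (q : R) (s n : ℕ) (f : ℕ → R) :
    ∑ τ : Equiv.Perm (Fin (n + 1)), q ^ rmaj (s + 1) τ * f (rdes (s + 1) τ)
      = ∑ σ : Equiv.Perm (Fin n), q ^ rmaj (s + 1) σ *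
          stepOp q n (min s n) f (rdes (s + 1) σ) := by
  rw [sum_insertPerm_position (Fin.last n), sum_comm]
  refine sum_congr rfl fun σ _ => ?_
  have hr : 1 ≤ s + 1 := by omega
  have h := sum_pow_label q (SpecialGap (s + 1) n (word σ)) (n + 1)
    (f (rdes (s + 1) σ)) (f (rdes (s + 1) σ + 1))
  rw [card_specialGap hr σ, Nat.add_sub_cancel] at h
  rw [stepOp, ← h, ← Fin.sum_univ_eq_sum_range
    (fun i => q ^ label (SpecialGap (s + 1) n (word σ)) (n + 1) i *
      if SpecialGap (s + 1) n (word σ) i then f (rdes (s + 1) σ) else f (rdes (s + 1) σ + 1)),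
    mul_sum]
  refine sum_congr rfl fun i _ => ?_
  rw [rmaj_insertPerm hr, rdes_insertPerm hr, pow_add]
  split_ifs
  · rw [add_zero]; ring
  · ring

lemma sum_rmaj_of_le {R : Type*} [CommRing R] (q : R) {n s : ℕ} (hn : n ≤ s) (f : ℕ → R) :
    ∑ σ : Equiv.Perm (Fin n), q ^ rmaj (s + 1) σ * f (rdes (s + 1) σ)
      = (∏ i ∈ range n, qInt q (i + 1)) * f 0 := by
  induction n generalizing f with
  | zero => simp [rmaj, rdes, rdesPairs]
  | succ n ih =>
    rw [sum_rmaj_recursion, ih (by omega), stepOp, prod_range_succ, min_eq_right (by omega)]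
    simp [mul_assoc]

end MaxInsertion

lemma sum_den_eq_sum_rmaj {R : Type*} [CommRing R] (q : R) (s n : ℕ) (f : ℕ → R) :
    ∑ σ : Equiv.Perm (Fin n), q ^ den σ * f (excLvl (s + 1) σ)
      = ∑ σ : Equiv.Perm (Fin n), q ^ rmaj (s + 1) σ * f (rdes (s + 1) σ) := by
  simp only [den_eq_cycDen, excLvl_eq_hits]
  rcases le_total n s with h | h
  · rw [sum_cycDen_of_le q h _ (fun k hk => hk), sum_rmaj_of_le q h]
  · obtain ⟨m, rfl⟩ := Nat.exists_eq_add_of_le h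
    clear h
    induction m generalizing f with
    | zero => rw [add_zero, sum_cycDen_of_le q le_rfl _ (fun k hk => hk), sum_rmaj_of_le q le_rfl]
    | succ m ih =>
      refine (sum_cycDen_recursion q s m f).trans ((ih _).trans ?_)
      have h := sum_rmaj_recursion q s (s + m) f
      rw [min_eq_left (by omega)] at h
      exact h.symm

/-- Theorem 1.3: `(exc_r, den)` is `r`-Euler–Mahonian, i.e. `(exc_r, den)` is
equidistributed with `(rdes, rmaj)` over `S_n`. -/
theorem excLvl_den_is_r_euler_mahonian (r n : ℕ) (hr : 1 ≤ r) (hn : 1 ≤ n) (a b : ℕ) :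
    ((univ : Finset (Equiv.Perm (Fin n))).filter fun σ =>
        excLvl r σ = a ∧ den σ = b).card
      = ((univ : Finset (Equiv.Perm (Fin n))).filter fun σ =>
          rdes r σ = a ∧ rmaj r σ = b).card := by
  obtain ⟨s, rfl⟩ : ∃ s, r = s + 1 := ⟨r - 1, by omega⟩
  have coeff_sum (g h : Equiv.Perm (Fin n) → ℕ) :
      (∑ σ, (Polynomial.X : Polynomial ℤ) ^ h σ * if g σ = a then 1 else 0).coeff b
        = ((univ.filter fun σ => g σ = a ∧ h σ = b).card : ℤ) := by
    rw [Polynomial.finsetSum_coeff, card_filter, Nat.cast_sum]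
    refine sum_congr rfl fun σ _ => ?_
    by_cases hg : g σ = a <;> simp [hg, Polynomial.coeff_X_pow, eq_comm]
  have := congrArg (fun P => Polynomial.coeff P b)
    (sum_den_eq_sum_rmaj (Polynomial.X : Polynomial ℤ) s n fun d => if d = a then 1 else 0)
  simp only [coeff_sum] at this
  exact_mod_cast this

end PaperStmt
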